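/- arXiv:2203.00106 — 5 statements merged into one kernel-verified Lean document; each statement's English description precedes it below -/
import Mathlib

section
/- Let Y be a real Hilbert space, μ > 0, and Q a μ-unmonotone multifunction on Y whose domain D(Q) is all of Y. Suppose that the multifunction −Q − μI (with graph {(y, −q − μy) : (y, q) ∈ G(Q)}) is maximally monotone, and let M be a maximally monotone multifunction on Y. Then G(M) ∩ G(Q) is nonempty. -/
open scoped RealInnerProductSpace

/-- A multifunction on `Y`, identified with its graph `G ⊆ Y × Y`, is monotone. -/
def IsMonotoneGraph {Y : Type*} [NormedAddCommGroup Y] [InnerProductSpace ℝ Y]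
    (G : Set (Y × Y)) : Prop :=
  ∀ p ∈ G, ∀ q ∈ G, 0 ≤ ⟪p.1 - q.1, p.2 - q.2⟫

/-- A multifunction on `Y` is maximally monotone: it is monotone and its graph is not
properly contained in the graph of any other monotone multifunction. -/
def IsMaxMonotoneGraph {Y : Type*} [NormedAddCommGroup Y] [InnerProductSpace ℝ Y]
    (G : Set (Y × Y)) : Prop :=
  IsMonotoneGraph G ∧ ∀ G' : Set (Y × Y), IsMonotoneGraph G' → G ⊆ G' → G' = G

/-- A multifunction on `Y` is `μ`-unmonotone. -/
def IsUnmonotone {Y : Type*} [NormedAddCommGroup Y] [InnerProductSpace ℝ Y]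
    (μ : ℝ) (G : Set (Y × Y)) : Prop :=
  ∀ p ∈ G, ∀ q ∈ G,
    ⟪p.1 - q.1, p.2 - q.2⟫ + μ * (‖p.1 - q.1‖ ^ 2 + ‖p.2 - q.2‖ ^ 2) ≤ 0

open Filter Topology in
/-- A closed convex set `E ⊆ H × ℝ` on which `t + ‖z‖² / 2` is bounded below contains a point
minimizing this function. -/
theorem exists_isMinOn_add_half_norm_sq {H : Type*} [NormedAddCommGroup H]
    [InnerProductSpace ℝ H] [CompleteSpace H] {E : Set (H × ℝ)} (hconv : Convex ℝ E)
    (hclosed : IsClosed E) (hne : E.Nonempty) {c : ℝ}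
    (hbdd : ∀ p ∈ E, c ≤ p.2 + ‖p.1‖ ^ 2 / 2) :
    ∃ p₀ ∈ E, ∀ p ∈ E, p₀.2 + ‖p₀.1‖ ^ 2 / 2 ≤ p.2 + ‖p.1‖ ^ 2 / 2 := by
  set v : H × ℝ → ℝ := fun p => p.2 + ‖p.1‖ ^ 2 / 2 with hv
  have hbelow : BddBelow (v '' E) := ⟨c, by rintro _ ⟨p, hp, rfl⟩; exact hbdd p hp⟩
  set α := sInf (v '' E)
  have hα : ∀ p ∈ E, α ≤ v p := fun p hp => csInf_le hbelow ⟨p, hp, rfl⟩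
  have hseq : ∀ n : ℕ, ∃ p ∈ E, v p < α + 1 / ((n : ℝ) + 1) := fun n => by
    obtain ⟨_, ⟨p, hp, rfl⟩, hlt⟩ := exists_lt_of_csInf_lt (hne.image v)
      (lt_add_of_pos_right α (Nat.one_div_pos_of_nat (α := ℝ) (n := n)))
    exact ⟨p, hp, hlt⟩
  choose p hpE hpv using hseq
  have hdist : ∀ a ∈ E, ∀ b ∈ E, ‖a.1 - b.1‖ ^ 2 ≤ 4 * (v a + v b - 2 * α) := by
    intro a ha b hb
    have hmid := hα _ (hconv ha hb (by norm_num : (0 : ℝ) ≤ 1 / 2)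
      (by norm_num : (0 : ℝ) ≤ 1 / 2) (by norm_num))
    have hpar := parallelogram_law_with_norm ℝ a.1 b.1
    simp only [hv, Prod.fst_add, Prod.snd_add, Prod.smul_fst, Prod.smul_snd, smul_eq_mul,
      ← smul_add, norm_smul] at hmid ⊢
    norm_num [mul_pow] at hmid
    nlinarith
  have hlim0 : Tendsto (fun n : ℕ => 1 / ((n : ℝ) + 1)) atTop (𝓝 0) :=
    tendsto_one_div_add_atTop_nhds_zero_nat
  have hcauchy : CauchySeq fun n => (p n).1 := by
    refine cauchySeq_of_le_tendsto_0 (fun n : ℕ => √(8 * (1 / ((n : ℝ) + 1)))) ?_ ?_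
    · intro n m N hn hm
      rw [dist_eq_norm]
      refine Real.le_sqrt_of_sq_le ?_
      have h₁ := hdist _ (hpE n) _ (hpE m)
      have h₂ := Nat.one_div_le_one_div (α := ℝ) hn
      have h₃ := Nat.one_div_le_one_div (α := ℝ) hm
      linarith [hpv n, hpv m]
    · simpa using (hlim0.const_mul 8).sqrt
  obtain ⟨z, hz⟩ := cauchySeq_tendsto_of_complete hcauchy
  have hvlim : Tendsto (fun n => v (p n)) atTop (𝓝 α) :=
    tendsto_of_tendsto_of_tendsto_of_le_of_le tendsto_const_nhds
      (by simpa using hlim0.const_add α) (fun n => hα _ (hpE n)) fun n => (hpv n).le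
  have ht : Tendsto (fun n => (p n).2) atTop (𝓝 (α - ‖z‖ ^ 2 / 2)) := by
    refine (hvlim.sub ((hz.norm.pow 2).div_const 2)).congr fun n => ?_
    simp [hv]
  refine ⟨(z, α - ‖z‖ ^ 2 / 2), hclosed.mem_of_tendsto (hz.prodMk_nhds ht)
    (Eventually.of_forall hpE), fun q hq => ?_⟩
  simpa using hα q hq

open Filter Topology in
/-- The first-order optimality condition for minimizers of `t + ‖z‖² / 2` on a convex set. -/
theorem sub_inner_le_of_isMinOn_add_half_norm_sq {H : Type*} [NormedAddCommGroup H]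
    [InnerProductSpace ℝ H] {E : Set (H × ℝ)} (hconv : Convex ℝ E) {p₀ : H × ℝ} (hp₀ : p₀ ∈ E)
    (hmin : ∀ p ∈ E, p₀.2 + ‖p₀.1‖ ^ 2 / 2 ≤ p.2 + ‖p.1‖ ^ 2 / 2) {p : H × ℝ} (hp : p ∈ E) :
    p₀.2 - ⟪p₀.1, p.1 - p₀.1⟫ ≤ p.2 := by
  have hstep : ∀ s : ℝ, 0 < s → s ≤ 1 →
      p₀.2 - ⟪p₀.1, p.1 - p₀.1⟫ - p.2 ≤ s * (‖p.1 - p₀.1‖ ^ 2 / 2) := by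
    intro s hs hs1
    have h := hmin _ (hconv.add_smul_sub_mem hp₀ hp ⟨hs.le, hs1⟩)
    simp only [Prod.fst_add, Prod.snd_add, Prod.smul_fst, Prod.smul_snd, Prod.fst_sub,
      Prod.snd_sub, smul_eq_mul, norm_add_sq_real, norm_smul, inner_smul_right, mul_pow,
      Real.norm_eq_abs, sq_abs] at h
    refine le_of_mul_le_mul_left ?_ hs
    linarith
  have hlim : Tendsto (fun s : ℝ => s * (‖p.1 - p₀.1‖ ^ 2 / 2)) (𝓝[>] 0) (𝓝 0) := by
    have : Continuous fun s : ℝ => s * (‖p.1 - p₀.1‖ ^ 2 / 2) := by fun_prop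
    simpa using (this.tendsto 0).mono_left nhdsWithin_le_nhds
  have hle := ge_of_tendsto hlim (by
    filter_upwards [Ioc_mem_nhdsGT (zero_lt_one' ℝ)] with s hs using hstep s hs.1 hs.2)
  linarith

section MaxMonotone

variable {Y : Type*} [NormedAddCommGroup Y] [InnerProductSpace ℝ Y]

/-- A point monotonically related to a maximally monotone graph belongs to it. -/
theorem IsMaxMonotoneGraph.mem_of_forall {M : Set (Y × Y)} (hM : IsMaxMonotoneGraph M)
    {x : Y × Y} (hx : ∀ p ∈ M, 0 ≤ ⟪x.1 - p.1, x.2 - p.2⟫) : x ∈ M := by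
  have hmono : IsMonotoneGraph (insert x M) := by
    rintro p (rfl | hp) q (rfl | hq)
    · simp
    · exact hx q hq
    · rw [← inner_neg_neg, neg_sub, neg_sub]
      exact hx p hp
    · exact hM.1 p hp q hq
  rw [← hM.2 _ hmono (Set.subset_insert x M)]
  exact Set.mem_insert x M

theorem IsMaxMonotoneGraph.nonempty {M : Set (Y × Y)} (hM : IsMaxMonotoneGraph M) :
    M.Nonempty := by
  by_contra h
  rw [Set.not_nonempty_iff_eq_empty] at h
  have : (0 : Y × Y) ∈ M := hM.mem_of_forall (by simp [h])
  simp [h] at this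

/-- The inverse image of a maximally monotone graph under `(y, m) ↦ (y, a • m + b)`
with `a > 0` is maximally monotone. -/
theorem IsMaxMonotoneGraph.preimage_affine {M : Set (Y × Y)} (hM : IsMaxMonotoneGraph M)
    {a : ℝ} (ha : 0 < a) (b : Y) :
    IsMaxMonotoneGraph {p : Y × Y | (p.1, a • p.2 + b) ∈ M} := by
  have hinner : ∀ p q : Y × Y, ⟪p.1 - q.1, (a • p.2 + b) - (a • q.2 + b)⟫
      = a * ⟪p.1 - q.1, p.2 - q.2⟫ := fun p q => by
    rw [add_sub_add_right_eq_sub, ← smul_sub, inner_smul_right]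
  refine ⟨fun p hp q hq => ?_, fun G hG hsub => ?_⟩
  · have h := hM.1 _ hp _ hq
    simp only [hinner] at h
    exact nonneg_of_mul_nonneg_right h ha
  · refine (hsub.antisymm fun p hp => ?_).symm
    refine hM.mem_of_forall fun q hq => ?_
    have hq' : (q.1, a⁻¹ • (q.2 - b)) ∈ G := hsub (by
      simpa [smul_smul, ha.ne'] using hq)
    have h := mul_nonneg ha.le (hG p hp _ hq')
    rw [← hinner] at h
    simpa [smul_smul, ha.ne'] using h

/-- The epigraph of the Fitzpatrick function of a graph. -/
def fitzpatrickEpigraph (M : Set (Y × Y)) : Set (WithLp 2 (Y × Y) × ℝ) :=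
  {w | ∀ p ∈ M, ⟪w.1.fst, p.2⟫ + ⟪p.1, w.1.snd⟫ - ⟪p.1, p.2⟫ ≤ w.2}

theorem convex_fitzpatrickEpigraph (M : Set (Y × Y)) : Convex ℝ (fitzpatrickEpigraph M) := by
  intro w hw w' hw' a b ha hb hab p hp
  have h := add_le_add (mul_le_mul_of_nonneg_left (hw p hp) ha)
    (mul_le_mul_of_nonneg_left (hw' p hp) hb)
  simp only [Prod.fst_add, Prod.snd_add, Prod.smul_fst, Prod.smul_snd, WithLp.add_fst,
    WithLp.add_snd, WithLp.smul_fst, WithLp.smul_snd, inner_add_left, inner_add_right,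
    real_inner_smul_left, real_inner_smul_right, smul_eq_mul]
  linear_combination h + ⟪p.1, p.2⟫ * hab

theorem isClosed_fitzpatrickEpigraph (M : Set (Y × Y)) : IsClosed (fitzpatrickEpigraph M) := by
  simp only [fitzpatrickEpigraph, Set.ofPred_forall]
  refine isClosed_iInter fun p => isClosed_iInter fun _ => isClosed_le ?_ continuous_snd
  have h₁ : Continuous fun w : WithLp 2 (Y × Y) × ℝ => w.1.fst :=
    (WithLp.fstL 2 ℝ Y Y).continuous.comp continuous_fst
  have h₂ : Continuous fun w : WithLp 2 (Y × Y) × ℝ => w.1.snd :=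
    (WithLp.sndL 2 ℝ Y Y).continuous.comp continuous_fst
  fun_prop

theorem IsMonotoneGraph.mem_fitzpatrickEpigraph {M : Set (Y × Y)} (hM : IsMonotoneGraph M)
    {p : Y × Y} (hp : p ∈ M) : (WithLp.toLp 2 p, ⟪p.1, p.2⟫) ∈ fitzpatrickEpigraph M := by
  intro q hq
  have h := hM p hp q hq
  simp only [inner_sub_left, inner_sub_right] at h
  change ⟪p.1, q.2⟫ + ⟪q.1, p.2⟫ - ⟪q.1, q.2⟫ ≤ ⟪p.1, p.2⟫
  linarith

theorem IsMaxMonotoneGraph.inner_le_of_mem_fitzpatrickEpigraph {M : Set (Y × Y)}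
    (hM : IsMaxMonotoneGraph M) {w : WithLp 2 (Y × Y) × ℝ} (hw : w ∈ fitzpatrickEpigraph M) :
    ⟪w.1.fst, w.1.snd⟫ ≤ w.2 := by
  by_contra! hlt
  have hmem : (w.1.fst, w.1.snd) ∈ M := hM.mem_of_forall fun q hq => by
    have h := hw q hq
    simp only [inner_sub_left, inner_sub_right]
    linarith
  have h := hw _ hmem
  simp only at h
  linarith

theorem IsMaxMonotoneGraph.exists_mem_neg [CompleteSpace Y] {M : Set (Y × Y)}
    (hM : IsMaxMonotoneGraph M) : ∃ x, (x, -x) ∈ M := by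
  obtain ⟨p₁, hp₁⟩ := hM.nonempty
  obtain ⟨⟨z, t⟩, hE, hmin⟩ := exists_isMinOn_add_half_norm_sq (convex_fitzpatrickEpigraph M)
    (isClosed_fitzpatrickEpigraph M) ⟨_, hM.1.mem_fitzpatrickEpigraph hp₁⟩ (c := 0)
    fun w hw => by
      have h₁ := hM.inner_le_of_mem_fitzpatrickEpigraph hw
      have h₂ := norm_add_sq_real w.1.fst w.1.snd
      rw [WithLp.prod_norm_sq_eq_of_L2]
      linarith [sq_nonneg ‖w.1.fst + w.1.snd‖]
  have hle : ∀ p ∈ M, ‖z.fst + z.snd‖ ^ 2 ≤ ⟪-z.snd - p.1, -z.fst - p.2⟫ := by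
    intro p hp
    have h₁ := hM.inner_le_of_mem_fitzpatrickEpigraph hE
    have h₂ := sub_inner_le_of_isMinOn_add_half_norm_sq (convex_fitzpatrickEpigraph M) hE hmin
      (hM.1.mem_fitzpatrickEpigraph hp)
    simp only [WithLp.prod_inner_apply, inner_sub_right, real_inner_self_eq_norm_sq] at h₁ h₂
    rw [norm_add_sq_real]
    simp only [inner_sub_left, inner_sub_right, inner_neg_left, inner_neg_right]
    rw [real_inner_comm z.fst z.snd, real_inner_comm z.fst p.1]
    change t - (⟪z.fst, p.1⟫ + ⟪z.snd, p.2⟫ - (‖z.fst‖ ^ 2 + ‖z.snd‖ ^ 2)) ≤ ⟪p.1, p.2⟫ at h₂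
    linarith
  have hmem : (-z.snd, -z.fst) ∈ M := hM.mem_of_forall fun p hp =>
    (sq_nonneg _).trans (hle p hp)
  have h0 : z.fst + z.snd = 0 := by
    have h := hle _ hmem
    simp only [sub_self, inner_zero_left] at h
    simpa using le_antisymm h (sq_nonneg _)
  refine ⟨-z.snd, ?_⟩
  rwa [eq_neg_of_add_eq_zero_left h0] at hmem

/-- **Minty's theorem**: `I + r M` is surjective for `M` maximally monotone and `r > 0`. -/
theorem IsMaxMonotoneGraph.exists_mem_add_smul_eq [CompleteSpace Y] {M : Set (Y × Y)}
    (hM : IsMaxMonotoneGraph M) {r : ℝ} (hr : 0 < r) (z : Y) :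
    ∃ p ∈ M, p.1 + r • p.2 = z := by
  obtain ⟨x, hx⟩ := (hM.preimage_affine (inv_pos.2 hr) (r⁻¹ • z)).exists_mem_neg
  refine ⟨_, hx, ?_⟩
  simp [smul_smul, hr.ne']

/-- Resolvents of monotone graphs are nonexpansive. -/
theorem IsMonotoneGraph.norm_sub_le {M : Set (Y × Y)} (hM : IsMonotoneGraph M) {r : ℝ}
    (hr : 0 ≤ r) {p q : Y × Y} (hp : p ∈ M) (hq : q ∈ M) :
    ‖p.1 - q.1‖ ≤ ‖(p.1 + r • p.2) - (q.1 + r • q.2)‖ := by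
  have h := mul_nonneg hr (hM p hp q hq)
  rw [add_sub_add_comm, ← smul_sub]
  refine le_of_sq_le_sq ?_ (norm_nonneg _)
  rw [norm_add_sq_real, inner_smul_right]
  linarith [sq_nonneg ‖r • (p.2 - q.2)‖]

/-- If `Q` is `μ`-unmonotone then `I + μ Q` is Lipschitz with squared constant `1 - 2 μ²`. -/
theorem IsUnmonotone.norm_add_smul_sub_sq_le {μ : ℝ} (hμ : 0 ≤ μ) {Q : Set (Y × Y)}
    (hQ : IsUnmonotone μ Q) {p q : Y × Y} (hp : p ∈ Q) (hq : q ∈ Q) :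
    ‖(p.1 + μ • p.2) - (q.1 + μ • q.2)‖ ^ 2 ≤ (1 - 2 * μ ^ 2) * ‖p.1 - q.1‖ ^ 2 := by
  have h := mul_le_mul_of_nonneg_left (hQ p hp q hq) hμ
  rw [add_sub_add_comm, ← smul_sub, norm_add_sq_real, inner_smul_right, norm_smul, mul_pow,
    Real.norm_eq_abs, sq_abs]
  nlinarith [mul_nonneg (sq_nonneg μ) (sq_nonneg ‖p.2 - q.2‖)]

end MaxMonotone

theorem stmt_2 {Y : Type*} [NormedAddCommGroup Y] [InnerProductSpace ℝ Y] [CompleteSpace Y]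
    (μ : ℝ) (hμ : 0 < μ) (Q : Set (Y × Y)) (hQ : IsUnmonotone μ Q)
    (hdom : ∀ y : Y, ∃ q : Y, (y, q) ∈ Q)
    (hmax : IsMaxMonotoneGraph {p : Y × Y | ∃ q : Y, (p.1, q) ∈ Q ∧ p.2 = -q - μ • p.1})
    (M : Set (Y × Y)) (hM : IsMaxMonotoneGraph M) :
    (M ∩ Q).Nonempty := by
  choose f hf using hdom
  choose J hJM hJ using hM.exists_mem_add_smul_eq hμ
  have hcontr : ContractingWith (NNReal.sqrt (1 - 2 * μ ^ 2).toNNReal)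
      fun y => (J (y + μ • f y)).1 := by
    refine ⟨?_, LipschitzWith.of_dist_le_mul fun x y => ?_⟩
    · rw [← NNReal.sqrt_one, NNReal.sqrt_lt_sqrt, Real.toNNReal_lt_one]
      nlinarith
    · have h₁ := hM.1.norm_sub_le hμ.le (hJM (x + μ • f x)) (hJM (y + μ • f y))
      rw [hJ, hJ] at h₁
      have h₂ := hQ.norm_add_smul_sub_sq_le hμ.le (hf x) (hf y)
      rw [dist_eq_norm, dist_eq_norm]
      refine h₁.trans (le_of_sq_le_sq ?_ (by positivity))
      rw [mul_pow, Real.coe_sqrt, Real.sq_sqrt NNReal.zero_le_coe, Real.coe_toNNReal']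
      exact h₂.trans (mul_le_mul_of_nonneg_right (le_max_left _ _) (sq_nonneg _))
  set y := hcontr.fixedPoint _
  have hfix : (J (y + μ • f y)).1 = y := hcontr.fixedPoint_isFixedPt
  have hsnd : (J (y + μ • f y)).2 = f y := by
    have h := hJ (y + μ • f y)
    rw [hfix] at h
    exact smul_right_injective Y hμ.ne' (add_left_cancel h)
  refine ⟨(y, f y), ?_, hf y⟩
  rw [← hsnd]
  nth_rewrite 1 [← hfix]
  exact hJM _
end

section
/- Let Y be a real Hilbert space, μ > 0, and Q a μ-unmonotone multifunction on Y whose domain D(Q) is all of Y. Suppose that the multifunction −Q − μI (with graph {(y, −q − μy) : (y, q) ∈ G(Q)}) is maximally monotone. Then Q touches every maximally monotone multifunction on Y; that is, for every maximally monotone multifunction M on Y, the set G(M) ∩ G(Q) is a singleton in Y × Y. -/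
open scoped RealInnerProductSpace

open Filter Topology

/-- A closed convex set `A ⊆ V × ℝ` on which `t + ‖v‖² / 2` is nonnegative contains a minimizer
of that function; the conclusion is the variational inequality characterizing it. -/
theorem exists_variational_inequality {V : Type*} [NormedAddCommGroup V]
    [InnerProductSpace ℝ V] [CompleteSpace V] (A : Set (V × ℝ)) (hclosed : IsClosed A)
    (hconv : Convex ℝ A) (hne : A.Nonempty) (hbdd : ∀ p ∈ A, 0 ≤ p.2 + ‖p.1‖ ^ 2 / 2) :
    ∃ p ∈ A, ∀ q ∈ A, p.2 - ⟪p.1, q.1 - p.1⟫ ≤ q.2 := by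
  let φ : V × ℝ → ℝ := fun p => p.2 + ‖p.1‖ ^ 2 / 2
  have hbelow : BddBelow (φ '' A) := ⟨0, by rintro _ ⟨p, hp, rfl⟩; exact hbdd p hp⟩
  obtain ⟨m, hm⟩ : ∃ m, m = sInf (φ '' A) := ⟨_, rfl⟩
  have hm_le : ∀ p ∈ A, m ≤ φ p := fun p hp => hm ▸ csInf_le hbelow ⟨p, hp, rfl⟩
  have hnear : ∀ n : ℕ, ∃ p ∈ A, φ p < m + 1 / ((n : ℝ) + 1) := by
    intro n
    have hlt : sInf (φ '' A) < m + 1 / ((n : ℝ) + 1) := by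
      rw [← hm]; exact lt_add_of_pos_right _ Nat.one_div_pos_of_nat
    obtain ⟨_, ⟨p, hp, rfl⟩, h⟩ := exists_lt_of_csInf_lt (hne.image φ) hlt
    exact ⟨p, hp, h⟩
  choose u huA hu using hnear
  have hdist : ∀ n k : ℕ,
      ‖(u n).1 - (u k).1‖ ^ 2 ≤ 4 * (1 / ((n : ℝ) + 1) + 1 / ((k : ℝ) + 1)) := by
    intro n k
    have hmid := hm_le _ (hconv (huA n) (huA k) (by norm_num : (0 : ℝ) ≤ 1 / 2)
      (by norm_num : (0 : ℝ) ≤ 1 / 2) (by norm_num))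
    have hn := hu n
    have hk := hu k
    simp only [φ, Prod.snd_add, Prod.fst_add, Prod.smul_snd, Prod.smul_fst, smul_eq_mul,
      ← smul_add, norm_smul, mul_pow] at hmid hn hk
    have hpar := parallelogram_law_with_norm ℝ (u n).1 (u k).1
    norm_num at hmid
    nlinarith
  have hcauchy : CauchySeq fun n => (u n).1 := by
    rw [Metric.cauchySeq_iff']
    intro ε hε
    obtain ⟨N, hN⟩ := exists_nat_one_div_lt (show (0 : ℝ) < ε ^ 2 / 8 by positivity)
    refine ⟨N, fun n hn => ?_⟩
    rw [dist_eq_norm]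
    refine lt_of_pow_lt_pow_left₀ 2 hε.le ?_
    have h1 := hdist n N
    have h2 : 1 / ((n : ℝ) + 1) ≤ 1 / ((N : ℝ) + 1) := Nat.one_div_le_one_div hn
    linarith
  obtain ⟨v, hv⟩ := cauchySeq_tendsto_of_complete hcauchy
  have hφ : Tendsto (fun n => φ (u n)) atTop (𝓝 m) := by
    refine tendsto_of_tendsto_of_tendsto_of_le_of_le tendsto_const_nhds
      (h := fun n : ℕ => m + 1 / ((n : ℝ) + 1)) ?_ (fun n => hm_le _ (huA n))
      (fun n => (hu n).le)
    simpa using tendsto_const_nhds (x := m).add (tendsto_one_div_add_atTop_nhds_zero_nat (𝕜 := ℝ))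
  have ht : Tendsto (fun n => (u n).2) atTop (𝓝 (m - ‖v‖ ^ 2 / 2)) := by
    have := hφ.sub ((hv.norm.pow 2).div_const 2)
    simpa [φ] using this
  have hpA : (v, m - ‖v‖ ^ 2 / 2) ∈ A :=
    hclosed.mem_of_tendsto (hv.prodMk_nhds ht) (Eventually.of_forall huA)
  refine ⟨_, hpA, fun q hq => ?_⟩
  by_contra! hlt
  simp only at hlt
  obtain ⟨c, hc⟩ : ∃ c, c = q.2 - (m - ‖v‖ ^ 2 / 2) + ⟪v, q.1 - v⟫ := ⟨_, rfl⟩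
  have hc0 : c < 0 := by linarith
  obtain ⟨d, hd⟩ : ∃ d, d = ‖q.1 - v‖ ^ 2 / 2 := ⟨_, rfl⟩
  have hd0 : 0 ≤ d := by rw [hd]; positivity
  have hsegment : ∀ s : ℝ, 0 < s → s ≤ 1 → 0 ≤ c + s * d := by
    intro s hs0 hs1
    have hmem := hm_le _ (hconv.add_smul_sub_mem hpA hq ⟨hs0.le, hs1⟩)
    simp only [φ, Prod.snd_add, Prod.fst_add, Prod.smul_snd, Prod.smul_fst, smul_eq_mul,
      Prod.fst_sub, Prod.snd_sub, norm_add_sq_real, norm_smul, mul_pow, inner_smul_right,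
      Real.norm_eq_abs, sq_abs] at hmem
    refine nonneg_of_mul_nonneg_right ?_ hs0
    rw [hc, hd]
    nlinarith
  have hpos : 0 < d - c := by linarith
  have h := hsegment (-c / (d - c)) (div_pos (by linarith) hpos)
    ((div_le_one hpos).2 (by linarith))
  have heq : c + -c / (d - c) * d = -(c ^ 2 / (d - c)) := by field_simp; ring
  have : 0 < c ^ 2 / (d - c) := div_pos (by nlinarith) hpos
  linarith

section MaximalMonotone

variable {Y : Type*} [NormedAddCommGroup Y] [InnerProductSpace ℝ Y]

theorem IsMaxMonotoneGraph.mem_of_related {M : Set (Y × Y)} (hM : IsMaxMonotoneGraph M)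
    {p : Y × Y} (hp : ∀ q ∈ M, 0 ≤ ⟪p.1 - q.1, p.2 - q.2⟫) : p ∈ M := by
  have hmono : IsMonotoneGraph (insert p M) := by
    rintro a (rfl | ha) b (rfl | hb)
    · simp
    · exact hp b hb
    · rw [← neg_sub b.1, ← neg_sub b.2, inner_neg_neg]
      exact hp a ha
    · exact hM.1 a ha b hb
  rw [← hM.2 _ hmono (Set.subset_insert p M)]
  exact Set.mem_insert p M

/-- Minty's theorem at the origin. The proof minimizes the sum of the Fitzpatrick function of `G`
and half the squared norm, expressed through the epigraph of the former. -/
theorem exists_mem_add_eq_zero [CompleteSpace Y] {G : Set (Y × Y)} (hG : IsMonotoneGraph G)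
    (hmem : ∀ p : Y × Y, (∀ q ∈ G, 0 ≤ ⟪p.1 - q.1, p.2 - q.2⟫) → p ∈ G) :
    ∃ p ∈ G, p.1 + p.2 = 0 := by
  let A : Set (WithLp 2 (Y × Y) × ℝ) :=
    {a | ∀ q ∈ G, ⟪a.1.fst, q.2⟫ + ⟪q.1, a.1.snd⟫ - ⟪q.1, q.2⟫ ≤ a.2}
  have hgraph : ∀ p ∈ G, (WithLp.toLp 2 p, ⟪p.1, p.2⟫) ∈ A := by
    intro p hp q hq
    have := hG p hp q hq
    simp only [inner_sub_left, inner_sub_right] at this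
    simp only [WithLp.toLp_fst, WithLp.toLp_snd]
    linarith
  have hfitz : ∀ a ∈ A, ⟪a.1.fst, a.1.snd⟫ ≤ a.2 := by
    intro a ha
    by_contra! hlt
    have hin : (a.1.fst, a.1.snd) ∈ G := by
      refine hmem _ fun q hq => ?_
      have := ha q hq
      simp only [inner_sub_left, inner_sub_right]
      linarith
    have := ha _ hin
    simp only at this
    linarith
  have hnorm : ∀ x : WithLp 2 (Y × Y), ‖x‖ ^ 2 = ‖x.fst‖ ^ 2 + ‖x.snd‖ ^ 2 :=
    WithLp.prod_norm_sq_eq_of_L2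
  have hclosed : IsClosed A := by
    simp only [A, Set.ofPred_forall]
    refine isClosed_biInter fun q _ => isClosed_le ?_ continuous_snd
    fun_prop
  have hconv : Convex ℝ A := by
    intro a ha b hb s t hs ht hst q hq
    have h1 := mul_le_mul_of_nonneg_left (ha q hq) hs
    have h2 := mul_le_mul_of_nonneg_left (hb q hq) ht
    simp only [Prod.fst_add, Prod.snd_add, Prod.smul_fst, Prod.smul_snd, WithLp.add_fst,
      WithLp.add_snd, WithLp.smul_fst, WithLp.smul_snd, inner_add_left, inner_add_right,
      real_inner_smul_left, real_inner_smul_right, smul_eq_mul]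
    have h3 : ⟪q.1, q.2⟫ = s * ⟪q.1, q.2⟫ + t * ⟪q.1, q.2⟫ := by rw [← add_mul, hst, one_mul]
    linarith
  have hne : A.Nonempty := by
    rcases G.eq_empty_or_nonempty with rfl | ⟨p, hp⟩
    · exact ⟨0, by simp [A]⟩
    · exact ⟨_, hgraph p hp⟩
  have hbdd : ∀ a ∈ A, 0 ≤ a.2 + ‖a.1‖ ^ 2 / 2 := by
    intro a ha
    have h1 := hfitz a ha
    have h2 := norm_add_sq_real a.1.fst a.1.snd
    have h3 := sq_nonneg ‖a.1.fst + a.1.snd‖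
    rw [hnorm]
    linarith
  obtain ⟨a, ha, hvar⟩ := exists_variational_inequality A hclosed hconv hne hbdd
  have hkey : ∀ q ∈ G,
      ‖a.1.fst + a.1.snd‖ ^ 2 ≤ ⟪-a.1.snd - q.1, -a.1.fst - q.2⟫ := by
    intro q hq
    have h1 := hvar _ (hgraph q hq)
    have h2 := hfitz a ha
    simp only [inner_sub_right, real_inner_self_eq_norm_sq,
      WithLp.prod_inner_apply] at h1
    rw [norm_add_sq_real]
    simp only [inner_sub_left, inner_sub_right, inner_neg_left, inner_neg_right]
    rw [real_inner_comm a.1.fst a.1.snd, real_inner_comm a.1.fst q.1]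
    simp at h1
    linarith
  have hin : (-a.1.snd, -a.1.fst) ∈ G :=
    hmem _ fun q hq => (sq_nonneg _).trans (hkey q hq)
  refine ⟨_, hin, ?_⟩
  have h := hkey _ hin
  simp only [sub_self, inner_zero_left] at h
  have h0 : a.1.fst + a.1.snd = 0 := by
    rw [← norm_eq_zero]
    exact pow_eq_zero_iff two_ne_zero |>.1 (le_antisymm h (sq_nonneg _))
  rw [← neg_add, add_comm, h0, neg_zero]

/-- Minty's theorem: `I + c M` is surjective for maximally monotone `M` and `c > 0`. -/
theorem IsMaxMonotoneGraph.exists_add_smul_eq [CompleteSpace Y] {M : Set (Y × Y)}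
    (hM : IsMaxMonotoneGraph M) {c : ℝ} (hc : 0 < c) (z : Y) :
    ∃ p ∈ M, p.1 + c • p.2 = z := by
  have hscale : ∀ p q : Y × Y, ⟪p.1 - q.1, c⁻¹ • (p.2 + z) - c⁻¹ • (q.2 + z)⟫ =
      c⁻¹ * ⟪p.1 - q.1, p.2 - q.2⟫ := by
    intro p q
    rw [← smul_sub, add_sub_add_right_eq_sub, real_inner_smul_right]
  obtain ⟨p, hp, hp0⟩ := exists_mem_add_eq_zero
    (G := {p : Y × Y | (p.1, c⁻¹ • (p.2 + z)) ∈ M})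
    (fun p hp q hq => by
      have := hM.1 _ hp _ hq
      simp only [hscale] at this
      exact nonneg_of_mul_nonneg_right this (inv_pos.2 hc))
    (fun p hp => hM.mem_of_related fun q hq => by
      have h := hp (q.1, c • q.2 - z) (by
        simpa only [Set.mem_ofPred_eq, sub_add_cancel, inv_smul_smul₀ hc.ne'] using hq)
      have h' := hscale p (q.1, c • q.2 - z)
      simp only [sub_add_cancel, inv_smul_smul₀ hc.ne'] at h'
      simp only at h ⊢
      rw [h']
      exact mul_nonneg (inv_pos.2 hc).le h)
  refine ⟨_, hp, ?_⟩
  simp only [smul_inv_smul₀ hc.ne']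
  rw [← add_assoc, hp0, zero_add]

/-- The resolvent of a monotone graph is nonexpansive. -/
theorem IsMonotoneGraph.norm_sub_le_norm_add_smul_sub {M : Set (Y × Y)}
    (hM : IsMonotoneGraph M) {c : ℝ} (hc : 0 ≤ c) {p q : Y × Y} (hp : p ∈ M) (hq : q ∈ M) :
    ‖p.1 - q.1‖ ≤ ‖(p.1 + c • p.2) - (q.1 + c • q.2)‖ := by
  refine le_of_sq_le_sq ?_ (norm_nonneg _)
  rw [add_sub_add_comm, ← smul_sub, norm_add_sq_real, real_inner_smul_right]
  nlinarith [mul_nonneg hc (hM p hp q hq), sq_nonneg ‖c • (p.2 - q.2)‖]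

/-- On a `μ`-unmonotone graph the forward step `y + μ q` is a contraction in `y`. -/
theorem IsUnmonotone.norm_add_smul_sub_le {μ : ℝ} (hμ : 0 < μ) {Q : Set (Y × Y)}
    (hQ : IsUnmonotone μ Q) {p q : Y × Y} (hp : p ∈ Q) (hq : q ∈ Q) :
    ‖(p.1 + μ • p.2) - (q.1 + μ • q.2)‖ ≤ √(1 / (1 + 2 * μ ^ 2)) * ‖p.1 - q.1‖ := by
  refine le_of_sq_le_sq ?_ (by positivity)
  rw [mul_pow, Real.sq_sqrt (by positivity), add_sub_add_comm, ← smul_sub, norm_add_sq_real,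
    real_inner_smul_right, norm_smul, mul_pow, Real.norm_eq_abs, sq_abs]
  have h := mul_le_mul_of_nonneg_left (hQ p hp q hq) hμ.le
  have hfactor : 1 - 2 * μ ^ 2 ≤ 1 / (1 + 2 * μ ^ 2) := by
    rw [le_div_iff₀ (by positivity)]
    nlinarith [sq_nonneg (μ ^ 2)]
  have h' := mul_le_mul_of_nonneg_right hfactor (sq_nonneg ‖p.1 - q.1‖)
  nlinarith [mul_nonneg (sq_nonneg μ) (sq_nonneg ‖p.2 - q.2‖)]

end MaximalMonotone

theorem stmt_3 {Y : Type*} [NormedAddCommGroup Y] [InnerProductSpace ℝ Y] [CompleteSpace Y]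
    (μ : ℝ) (hμ : 0 < μ) (Q : Set (Y × Y)) (hQ : IsUnmonotone μ Q)
    (hdom : ∀ y : Y, ∃ q : Y, (y, q) ∈ Q)
    (hmax : IsMaxMonotoneGraph {p : Y × Y | ∃ q : Y, (p.1, q) ∈ Q ∧ p.2 = -q - μ • p.1})
    (M : Set (Y × Y)) (hM : IsMaxMonotoneGraph M) :
    ∃ p : Y × Y, M ∩ Q = {p} := by
  choose T hT using hdom
  choose J hJM hJ using fun z => hM.exists_add_smul_eq hμ z
  let Φ : Y → Y := fun y => (J (y + μ • T y)).1
  have hK : √(1 / (1 + 2 * μ ^ 2)) < 1 := by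
    rw [Real.sqrt_lt' one_pos, one_pow, div_lt_one (by positivity)]
    nlinarith [pow_pos hμ 2]
  have hΦ : ContractingWith (√(1 / (1 + 2 * μ ^ 2))).toNNReal Φ := by
    refine ⟨by simpa using hK, LipschitzWith.of_dist_le_mul fun x y => ?_⟩
    rw [Real.coe_toNNReal _ (Real.sqrt_nonneg _), dist_eq_norm, dist_eq_norm]
    have h := hM.1.norm_sub_le_norm_add_smul_sub hμ.le (hJM (x + μ • T x)) (hJM (y + μ • T y))
    rw [hJ, hJ] at h
    exact h.trans (hQ.norm_add_smul_sub_le hμ (hT x) (hT y))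
  obtain ⟨y, hy⟩ : ∃ y, Φ y = y := ⟨_, hΦ.fixedPoint_isFixedPt⟩
  have hJy : J (y + μ • T y) = (y, T y) := by
    refine Prod.ext hy ?_
    have h := hJ (y + μ • T y)
    rw [show (J (y + μ • T y)).1 = y from hy] at h
    exact smul_right_injective Y hμ.ne' (add_left_cancel h)
  refine ⟨(y, T y), Set.eq_singleton_iff_unique_mem.2
    ⟨⟨hJy ▸ hJM (y + μ • T y), hT y⟩, fun p hp => ?_⟩⟩
  have h1 := hM.1 p hp.1 _ (hJy ▸ hJM (y + μ • T y))
  have h2 := hQ p hp.2 _ (hT y)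
  have h3 : ‖p.1 - y‖ ^ 2 + ‖p.2 - T y‖ ^ 2 ≤ 0 :=
    nonpos_of_mul_nonpos_right (by linarith) hμ
  have h4 : ‖p.1 - y‖ ^ 2 = 0 := by nlinarith [sq_nonneg ‖p.1 - y‖, sq_nonneg ‖p.2 - T y‖]
  have h5 : ‖p.2 - T y‖ ^ 2 = 0 := by nlinarith [sq_nonneg ‖p.1 - y‖, sq_nonneg ‖p.2 - T y‖]
  refine Prod.ext ?_ ?_
  · simpa [sub_eq_zero] using h4
  · simpa [sub_eq_zero] using h5
end

section
/- Let Y be a real Hilbert space, Q a bounded linear operator from Y to Y, and λ > 0 such that ⟪y, Qy⟫ + λ‖y‖² ≤ 0 for all y ∈ Y. Then Q touches every maximally monotone multifunction on Y; that is, for every maximally monotone multifunction M on Y there exists a unique pair (d, e) ∈ Y × Y with (d, e) ∈ G(M) and e = Qd. -/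
open scoped RealInnerProductSpace

open Filter Topology

/-- The interpolation identity for the quadratic form `u ↦ ⟪u, Q u⟫`. -/
lemma inner_map_self_lineMap {Y : Type*} [NormedAddCommGroup Y] [InnerProductSpace ℝ Y]
    (Q : Y →L[ℝ] Y) (u v : Y) (t : ℝ) :
    ⟪(1 - t) • u + t • v, Q ((1 - t) • u + t • v)⟫ =
      (1 - t) * ⟪u, Q u⟫ + t * ⟪v, Q v⟫ - t * (1 - t) * ⟪v - u, Q (v - u)⟫ := by
  simp only [map_add, map_sub, map_smul, inner_add_left, inner_add_right, inner_sub_left,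
    inner_sub_right, real_inner_smul_left, real_inner_smul_right]
  ring

/-- A variational inequality for the infimum of `r - ⟪u, Q u⟫` over a convex set of pairs
`(u, r)`, where `-Q` is coercive; the infimum need not be attained, but the first components of
minimizing sequences converge. -/
lemma exists_variational_inequality_s5 {Y : Type*} [NormedAddCommGroup Y] [InnerProductSpace ℝ Y]
    [CompleteSpace Y] (Q : Y →L[ℝ] Y) {lam : ℝ} (hlam : 0 < lam)
    (hQ : ∀ y : Y, ⟪y, Q y⟫ + lam * ‖y‖ ^ 2 ≤ 0) {T : Set (Y × ℝ)} (hT : Convex ℝ T)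
    (hpos : ∀ p ∈ T, 0 ≤ p.2 - ⟪p.1, Q p.1⟫) :
    ∃ d : Y, ∀ p ∈ T, -⟪p.1 - d, Q (p.1 - d)⟫ ≤ p.2 - ⟪p.1, Q p.1⟫ := by
  rcases T.eq_empty_or_nonempty with rfl | hne
  · exact ⟨0, by simp⟩
  set h : Y × ℝ → ℝ := fun p => p.2 - ⟪p.1, Q p.1⟫ with hh
  have hbdd : BddBelow (h '' T) := ⟨0, by rintro _ ⟨p, hp, rfl⟩; exact hpos p hp⟩
  set m := sInf (h '' T)
  have hm0 : 0 ≤ m := le_csInf (hne.image h) (by rintro _ ⟨p, hp, rfl⟩; exact hpos p hp)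
  have hmle : ∀ p ∈ T, m ≤ h p := fun p hp => csInf_le hbdd ⟨p, hp, rfl⟩
  have hseg : ∀ p ∈ T, ∀ p' ∈ T, ∀ t : ℝ, 0 ≤ t → t ≤ 1 →
      m ≤ (1 - t) * h p + t * h p' + t * (1 - t) * ⟪p'.1 - p.1, Q (p'.1 - p.1)⟫ := by
    intro p hp p' hp' t ht0 ht1
    refine (hmle _ (hT hp hp' (sub_nonneg.2 ht1) ht0 (by ring))).trans_eq ?_
    simp only [hh, Prod.fst_add, Prod.snd_add, Prod.smul_fst, Prod.smul_snd, smul_eq_mul,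
      inner_map_self_lineMap]
    ring
  obtain ⟨s, -, hs, hsT⟩ := exists_seq_tendsto_sInf (hne.image h) hbdd
  choose c hcT hcs using hsT
  have hlim : Tendsto (fun n => h (c n)) atTop (𝓝 m) := by simpa only [hcs] using hs
  have hcauchy : CauchySeq fun n => (c n).1 := by
    rw [Metric.cauchySeq_iff']
    intro ε hε
    have hev : ∀ᶠ n in atTop, h (c n) < m + lam / 4 * ε ^ 2 :=
      hlim.eventually (gt_mem_nhds (by linarith [show 0 < lam / 4 * ε ^ 2 by positivity]))
    obtain ⟨N, hN⟩ := eventually_atTop.1 hev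
    refine ⟨N, fun n hn => ?_⟩
    have h1 := hseg _ (hcT N) _ (hcT n) (1 / 2) (by norm_num) (by norm_num)
    have h2 := hQ ((c n).1 - (c N).1)
    have h3 := hN n hn
    have h4 := hN N le_rfl
    rw [dist_eq_norm]
    refine lt_of_pow_lt_pow_left₀ 2 hε.le (lt_of_mul_lt_mul_left ?_ hlam.le)
    linarith
  obtain ⟨d, hd⟩ := cauchySeq_tendsto_of_complete hcauchy
  refine ⟨d, fun p hp => ?_⟩
  set q := -⟪p.1 - d, Q (p.1 - d)⟫ with hq
  have hlimit : ∀ t : ℝ, 0 ≤ t → t ≤ 1 → m ≤ (1 - t) * m + t * h p - t * (1 - t) * q := by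
    intro t ht0 ht1
    have hconv : Tendsto (fun n => (1 - t) * h (c n) + t * h p +
        t * (1 - t) * ⟪p.1 - (c n).1, Q (p.1 - (c n).1)⟫) atTop
        (𝓝 ((1 - t) * m + t * h p + t * (1 - t) * ⟪p.1 - d, Q (p.1 - d)⟫)) := by
      have hsub := hd.const_sub p.1
      exact ((hlim.const_mul _).add_const _).add
        ((hsub.inner ((Q.continuous.tendsto _).comp hsub)).const_mul _)
    have := ge_of_tendsto' hconv fun n => hseg _ (hcT n) p hp t ht0 ht1
    rw [hq]
    linarith
  change q ≤ h p
  by_contra! hlt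
  have hp0 : 0 ≤ h p := hpos p hp
  have hq0 : 0 < q := hp0.trans_lt hlt
  set t := (q - h p) / (2 * q) with ht
  have ht0 : 0 < t := div_pos (sub_pos.2 hlt) (by linarith)
  have htq : t * q = (q - h p) / 2 := by rw [ht]; field_simp
  have ht1 : t ≤ 1 := by rw [ht, div_le_one (by linarith)]; linarith
  have := hlimit t ht0.le ht1
  have h1 : 0 ≤ t * (h p - m - (q - t * q)) := by linarith
  have h2 := nonneg_of_mul_nonneg_right h1 ht0
  linarith

/-- On the convex hull of the lifted graph `{(a, b, ⟪a, b⟫)}` of a monotone multifunction, the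
last coordinate dominates the duality product. -/
lemma IsMonotoneGraph.inner_le_of_mem_convexHull {Y : Type*} [NormedAddCommGroup Y]
    [InnerProductSpace ℝ Y] {M : Set (Y × Y)} (hM : IsMonotoneGraph M) {c : Y × Y × ℝ}
    (hc : c ∈ convexHull ℝ ((fun p : Y × Y => (p.1, p.2, ⟪p.1, p.2⟫)) '' M)) :
    ⟪c.1, c.2.1⟫ ≤ c.2.2 := by
  set S : Set (Y × Y × ℝ) := (fun p : Y × Y => (p.1, p.2, ⟪p.1, p.2⟫)) '' M
  have hconv : ∀ z : Y × Y × ℝ,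
      Convex ℝ {c : Y × Y × ℝ | ⟪z.1, c.2.1⟫ + ⟪c.1, z.2.1⟫ ≤ c.2.2 + z.2.2} := by
    intro z c hc c' hc' α β hα hβ hαβ
    simp only [Set.mem_ofPred_eq, Prod.fst_add, Prod.snd_add, Prod.smul_fst, Prod.smul_snd,
      smul_eq_mul, inner_add_left, inner_add_right, real_inner_smul_left,
      real_inner_smul_right] at hc hc' ⊢
    have hz : z.2.2 = α * z.2.2 + β * z.2.2 := by rw [← add_mul, hαβ, one_mul]
    linarith [mul_le_mul_of_nonneg_left hc hα, mul_le_mul_of_nonneg_left hc' hβ]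
  have hgen : ∀ z ∈ S, ∀ c ∈ convexHull ℝ S, ⟪z.1, c.2.1⟫ + ⟪c.1, z.2.1⟫ ≤ c.2.2 + z.2.2 := by
    rintro _ ⟨p, hp, rfl⟩ c hc
    refine convexHull_min ?_ (hconv (p.1, p.2, ⟪p.1, p.2⟫)) hc
    rintro _ ⟨p', hp', rfl⟩
    have := hM p hp p' hp'
    simp only [inner_sub_left, inner_sub_right] at this
    simp only [Set.mem_ofPred_eq]
    linarith
  have hself : ∀ c' ∈ convexHull ℝ S, ⟪c.1, c'.2.1⟫ + ⟪c'.1, c.2.1⟫ ≤ c'.2.2 + c.2.2 := by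
    intro c' hc'
    refine convexHull_min (fun z hz => ?_) (hconv c) hc'
    have := hgen z hz c hc
    simp only [Set.mem_ofPred_eq]
    linarith
  linarith [hself c hc]

/-- If `-Q` is coercive, then the symmetric operator `Q + Q†` is invertible. -/
lemma exists_continuousLinearEquiv_eq_add_adjoint {Y : Type*} [NormedAddCommGroup Y]
    [InnerProductSpace ℝ Y] [CompleteSpace Y] (Q : Y →L[ℝ] Y) {lam : ℝ} (hlam : 0 < lam)
    (hQ : ∀ y : Y, ⟪y, Q y⟫ + lam * ‖y‖ ^ 2 ≤ 0) :
    ∃ E : Y ≃L[ℝ] Y, ∀ u, E u = Q u + Q.adjoint u := by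
  set B : Y →L[ℝ] Y →L[ℝ] ℝ := (innerSL ℝ).comp (-(Q + Q.adjoint)) with hB
  have hBapp : ∀ u v, B u v = -⟪Q u + Q.adjoint u, v⟫ := fun u v => by
    simp [hB, inner_add_left]
  have hcoer : IsCoercive B := by
    refine ⟨2 * lam, by positivity, fun u => ?_⟩
    rw [hBapp, inner_add_left, ContinuousLinearMap.adjoint_inner_left, real_inner_comm]
    linarith [hQ u]
  refine ⟨hcoer.continuousLinearEquivOfBilin.trans (ContinuousLinearEquiv.neg ℝ), fun u => ?_⟩
  refine ext_inner_right ℝ fun v => ?_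
  have := hcoer.continuousLinearEquivOfBilin_apply u v
  rw [hBapp] at this
  simp [inner_neg_left, this]

/-- A point monotonically related to a maximally monotone graph belongs to it. -/
lemma IsMaxMonotoneGraph.mem_of_forall_inner_nonneg {Y : Type*} [NormedAddCommGroup Y]
    [InnerProductSpace ℝ Y] {M : Set (Y × Y)} (hM : IsMaxMonotoneGraph M) {z : Y × Y}
    (hz : ∀ p ∈ M, 0 ≤ ⟪p.1 - z.1, p.2 - z.2⟫) : z ∈ M := by
  rw [← hM.2 (insert z M) ?_ (Set.subset_insert z M)]
  · exact Set.mem_insert z M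
  rintro p (rfl | hp) q (rfl | hq)
  · simp
  · rw [← inner_neg_neg, neg_sub, neg_sub]
    exact hz q hq
  · exact hz p hp
  · exact hM.1 p hp q hq

theorem stmt_5 {Y : Type*} [NormedAddCommGroup Y] [InnerProductSpace ℝ Y] [CompleteSpace Y]
    (Q : Y →L[ℝ] Y) (lam : ℝ) (hlam : 0 < lam)
    (hQ : ∀ y : Y, ⟪y, Q y⟫ + lam * ‖y‖ ^ 2 ≤ 0)
    (M : Set (Y × Y)) (hM : IsMaxMonotoneGraph M) :
    ∃! p : Y × Y, p ∈ M ∧ p.2 = Q p.1 := by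
  obtain ⟨E, hE⟩ := exists_continuousLinearEquiv_eq_add_adjoint Q hlam hQ
  set D : Y × Y × ℝ →ₗ[ℝ] Y := (E.symm : Y →ₗ[ℝ] Y) ∘ₗ
    ((LinearMap.fst ℝ Y ℝ ∘ₗ LinearMap.snd ℝ Y (Y × ℝ)) +
      (Q.adjoint : Y →ₗ[ℝ] Y) ∘ₗ LinearMap.fst ℝ Y (Y × ℝ)) with hD
  set L : Y × Y × ℝ →ₗ[ℝ] Y × ℝ :=
    D.prod (LinearMap.snd ℝ Y ℝ ∘ₗ LinearMap.snd ℝ Y (Y × ℝ))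
  have hLapp : ∀ c, L c = (D c, c.2.2) := fun c => rfl
  have hsquare : ∀ (c : Y × Y × ℝ) (d : Y), ⟪D c - d, Q (D c - d)⟫ =
      ⟪D c, Q (D c)⟫ + ⟪d, Q d⟫ - ⟪d, c.2.1⟫ - ⟪c.1, Q d⟫ := by
    intro c d
    have hEq : Q (D c) + Q.adjoint (D c) = c.2.1 + Q.adjoint c.1 := by
      rw [← hE]
      simp [hD]
    have := congrArg (fun v => ⟪d, v⟫) hEq
    simp only [inner_add_right, ContinuousLinearMap.adjoint_inner_right] at this
    simp only [map_sub, inner_sub_left, inner_sub_right]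
    linarith [real_inner_comm (Q d) (D c), real_inner_comm (Q d) c.1]
  set S : Set (Y × Y × ℝ) := (fun p : Y × Y => (p.1, p.2, ⟪p.1, p.2⟫)) '' M
  obtain ⟨d, hd⟩ := exists_variational_inequality_s5 Q hlam hQ
    ((convex_convexHull ℝ S).linear_image L) (by
      rintro _ ⟨c, hc, rfl⟩
      have h1 := hM.1.inner_le_of_mem_convexHull hc
      have h2 := hsquare c c.1
      have h3 := hQ (D c - c.1)
      have h4 : 0 ≤ lam * ‖D c - c.1‖ ^ 2 := by positivity
      simp only [hLapp]
      linarith)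
  have hdM : (d, Q d) ∈ M := by
    refine hM.mem_of_forall_inner_nonneg fun p hp => ?_
    have h1 := hd _ ⟨_, subset_convexHull ℝ S ⟨p, hp, rfl⟩, rfl⟩
    have h2 := hsquare (p.1, p.2, ⟪p.1, p.2⟫) d
    simp only [hLapp] at h1 h2
    simp only [inner_sub_left, inner_sub_right]
    linarith
  refine ⟨(d, Q d), ⟨hdM, rfl⟩, ?_⟩
  rintro ⟨x, y⟩ ⟨hx, rfl : y = Q x⟩
  have h1 := hM.1 _ hx _ hdM
  have h2 := hQ (x - d)
  simp only [← map_sub] at h1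
  have h3 : lam * ‖x - d‖ ^ 2 ≤ 0 := by linarith
  have h4 : ‖x - d‖ ^ 2 ≤ 0 := nonpos_of_mul_nonpos_right h3 hlam
  have h5 : x = d := by
    rw [← sub_eq_zero, ← norm_eq_zero]
    exact pow_eq_zero_iff two_ne_zero |>.1 (le_antisymm h4 (by positivity))
  rw [h5]
end

section
/- Let X be a real Hilbert space and Y a closed subspace of X. Let Q be a bounded linear operator from X to Y such that ⟪y, Qy⟫ + ½‖y‖² = 0 for all y ∈ Y. Let f : X → (−∞, ∞] be proper, convex and lower semicontinuous, and suppose that the restriction f*|_Y of the Fenchel conjugate f* to Y is proper (hence belongs to Γ₀(Y)). Then there exists a unique pair (d, e) ∈ Y × Y such that e = Qd and e ∈ ∂(f*|_Y)(d). -/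
open scoped RealInnerProductSpace

noncomputable section

/-- `f` is a proper function into `(-∞, ∞]`: it never takes the value `⊥` and is
somewhere finite. -/
def IsProperFn {H : Type*} (f : H → EReal) : Prop :=
  (∀ x, f x ≠ ⊥) ∧ ∃ x, f x ≠ ⊤

/-- `f` is a convex extended-real-valued function. -/
def IsConvexFn {H : Type*} [AddCommGroup H] [Module ℝ H] (f : H → EReal) : Prop :=
  ∀ x y : H, ∀ a b : ℝ, 0 ≤ a → 0 ≤ b → a + b = 1 →
    f (a • x + b • y) ≤ (a : EReal) * f x + (b : EReal) * f y

/-- The Fenchel conjugate of `f`. -/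
def fenchel {H : Type*} [NormedAddCommGroup H] [InnerProductSpace ℝ H] (f : H → EReal) :
    H → EReal := fun p => ⨆ x : H, ((⟪x, p⟫ : ℝ) : EReal) - f x

/-- The subdifferential of `g` at `y`. -/
def subdiff {H : Type*} [NormedAddCommGroup H] [InnerProductSpace ℝ H] (g : H → EReal)
    (y : H) : Set H := {p | ∀ z : H, g y + ((⟪z - y, p⟫ : ℝ) : EReal) ≤ g z}

open Filter Topology

section Proximal

variable {H : Type*} [NormedAddCommGroup H] [InnerProductSpace ℝ H]

/-- The proximal objective `(y, t) ↦ ρ t + ‖y - z‖² / 2` attains its infimum on a nonempty closed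
convex set lying above the graph of an affine function. -/
theorem exists_forall_proximal_le [CompleteSpace H] {E : Set (H × ℝ)} (hne : E.Nonempty)
    (hcl : IsClosed E) (hco : Convex ℝ E) {a : H} {c : ℝ} (hlb : ∀ p ∈ E, ⟪a, p.1⟫ - c ≤ p.2)
    {ρ : ℝ} (hρ : 0 < ρ) (z : H) :
    ∃ p ∈ E, ∀ q ∈ E, ρ * p.2 + ‖p.1 - z‖ ^ 2 / 2 ≤ ρ * q.2 + ‖q.1 - z‖ ^ 2 / 2 := by
  set φ : H × ℝ → ℝ := fun p => ρ * p.2 + ‖p.1 - z‖ ^ 2 / 2 with hφ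
  have hbdd : BddBelow (φ '' E) := by
    refine ⟨ρ * (⟪a, z⟫ - c) - (ρ * ‖a‖) ^ 2 / 2, ?_⟩
    rintro _ ⟨p, hp, rfl⟩
    have h1 := mul_le_mul_of_nonneg_left (hlb p hp) hρ.le
    have h2 : ⟪a, p.1⟫ = ⟪a, z⟫ + ⟪a, p.1 - z⟫ := by rw [inner_sub_right]; ring
    have h3 : -(‖a‖ * ‖p.1 - z‖) ≤ ⟪a, p.1 - z⟫ :=
      (abs_le.1 (abs_real_inner_le_norm a (p.1 - z))).1
    have h4 := mul_le_mul_of_nonneg_left h3 hρ.le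
    rw [h2] at h1
    simp only [hφ]
    nlinarith [sq_nonneg (ρ * ‖a‖ - ‖p.1 - z‖)]
  set m := sInf (φ '' E)
  have hmle : ∀ q ∈ E, m ≤ φ q := fun q hq => csInf_le hbdd ⟨q, hq, rfl⟩
  have hex : ∀ n : ℕ, ∃ p ∈ E, φ p < m + 1 / ((n : ℝ) + 1) := fun n => by
    obtain ⟨_, ⟨p, hp, rfl⟩, hlt⟩ := exists_lt_of_csInf_lt (hne.image φ)
      (lt_add_of_pos_right m (Nat.one_div_pos_of_nat (n := n)))
    exact ⟨p, hp, hlt⟩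
  choose u huE hu using hex
  have hmid : ∀ p ∈ E, ∀ q ∈ E, ‖p.1 - q.1‖ ^ 2 ≤ 4 * (φ p - m + (φ q - m)) := by
    intro p hp q hq
    have h := hmle _ (hco hp hq (by norm_num : (0 : ℝ) ≤ 1 / 2) (by norm_num : (0 : ℝ) ≤ 1 / 2)
      (by norm_num))
    have hpar := parallelogram_law_with_norm ℝ (p.1 - z) (q.1 - z)
    have e1 : (1 / 2 : ℝ) • p.1 + (1 / 2 : ℝ) • q.1 - z
        = (1 / 2 : ℝ) • ((p.1 - z) + (q.1 - z)) := by module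
    have e2 : p.1 - z - (q.1 - z) = p.1 - q.1 := by abel
    simp only [hφ, Prod.fst_add, Prod.snd_add, Prod.smul_fst, Prod.smul_snd, e1, norm_smul,
      smul_eq_mul, Real.norm_eq_abs, abs_of_pos (by norm_num : (0 : ℝ) < 1 / 2)] at h ⊢
    rw [e2] at hpar
    nlinarith
  have hcau : CauchySeq fun n => (u n).1 := by
    refine cauchySeq_of_le_tendsto_0 (fun n : ℕ => √(8 * (1 / ((n : ℝ) + 1)))) ?_ ?_
    · intro k l n hk hl
      rw [dist_eq_norm]
      apply Real.le_sqrt_of_sq_le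
      have h1 := hmid _ (huE k) _ (huE l)
      have h2 := hu k
      have h3 := hu l
      have h4 := Nat.one_div_le_one_div (α := ℝ) hk
      have h5 := Nat.one_div_le_one_div (α := ℝ) hl
      linarith
    · have h := (tendsto_one_div_add_atTop_nhds_zero_nat (𝕜 := ℝ)).const_mul 8
      simpa using h.sqrt
  obtain ⟨d, hd⟩ := cauchySeq_tendsto_of_complete hcau
  have hφu : Tendsto (fun n => φ (u n)) atTop (𝓝 m) := by
    refine tendsto_of_tendsto_of_tendsto_of_le_of_le tendsto_const_nhds ?_
      (fun n => hmle _ (huE n)) (fun n => (hu n).le)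
    simpa using (tendsto_one_div_add_atTop_nhds_zero_nat (𝕜 := ℝ)).const_add m
  have hs : Tendsto (fun n => (u n).2) atTop (𝓝 ((m - ‖d - z‖ ^ 2 / 2) / ρ)) := by
    have h := (hφu.sub (((hd.sub_const z).norm.pow 2).div_const 2)).div_const ρ
    refine h.congr fun n => ?_
    simp only [hφ]
    field_simp
    ring
  refine ⟨(d, (m - ‖d - z‖ ^ 2 / 2) / ρ),
    hcl.mem_of_tendsto (hd.prodMk_nhds hs) (Eventually.of_forall huE), fun q hq => ?_⟩
  have h := hmle q hq
  have e : ρ * ((m - ‖d - z‖ ^ 2 / 2) / ρ) = m - ‖d - z‖ ^ 2 / 2 := by field_simp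
  simp only [hφ] at h
  simp only [e]
  linarith

/-- The variational inequality characterizing minimizers of the proximal objective. -/
theorem proximal_variational_inequality {E : Set (H × ℝ)} (hco : Convex ℝ E) {ρ : ℝ} {z : H}
    {p : H × ℝ} (hp : p ∈ E)
    (hmin : ∀ q ∈ E, ρ * p.2 + ‖p.1 - z‖ ^ 2 / 2 ≤ ρ * q.2 + ‖q.1 - z‖ ^ 2 / 2) :
    ∀ q ∈ E, ρ * p.2 + ⟪z - p.1, q.1 - p.1⟫ ≤ ρ * q.2 := by
  intro q hq
  have key : ∀ l ∈ Set.Ioo (0 : ℝ) 1,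
      ρ * p.2 + ⟪z - p.1, q.1 - p.1⟫ ≤ ρ * q.2 + l * (‖q.1 - p.1‖ ^ 2 / 2) := by
    rintro l ⟨hl0, hl1⟩
    have h := hmin _ (hco.add_smul_sub_mem hp hq ⟨hl0.le, hl1.le⟩)
    have e : p.1 + l • (q.1 - p.1) - z = l • (q.1 - p.1) - (z - p.1) := by abel
    simp only [Prod.fst_add, Prod.snd_add, Prod.smul_fst, Prod.smul_snd, Prod.fst_sub,
      Prod.snd_sub, smul_eq_mul, e] at h
    rw [norm_sub_sq_real (l • (q.1 - p.1)), norm_smul, real_inner_smul_left, norm_sub_rev p.1 z,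
      mul_pow, Real.norm_eq_abs, sq_abs, real_inner_comm] at h
    refine le_of_mul_le_mul_left ?_ hl0
    nlinarith
  have hlim : Tendsto (fun l : ℝ => ρ * q.2 + l * (‖q.1 - p.1‖ ^ 2 / 2)) (𝓝[>] 0)
      (𝓝 (ρ * q.2)) := by
    have hc : Continuous fun l : ℝ => ρ * q.2 + l * (‖q.1 - p.1‖ ^ 2 / 2) := by fun_prop
    simpa using (hc.tendsto 0).mono_left nhdsWithin_le_nhds
  refine ge_of_tendsto hlim ?_
  filter_upwards [Ioo_mem_nhdsGT (zero_lt_one' ℝ)] with l hl using key l hl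

/-- Solutions of the proximal variational inequality depend nonexpansively on the centre. -/
theorem proximal_nonexpansive {E : Set (H × ℝ)} {ρ : ℝ} {z w : H} {p q : H × ℝ}
    (hp : p ∈ E) (hq : q ∈ E)
    (hpv : ∀ r ∈ E, ρ * p.2 + ⟪z - p.1, r.1 - p.1⟫ ≤ ρ * r.2)
    (hqv : ∀ r ∈ E, ρ * q.2 + ⟪w - q.1, r.1 - q.1⟫ ≤ ρ * r.2) :
    ‖p.1 - q.1‖ ≤ ‖z - w‖ := by
  have h1 := hpv q hq
  have h2 := hqv p hp
  have e : ⟪z - p.1, q.1 - p.1⟫ + ⟪w - q.1, p.1 - q.1⟫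
      = ‖p.1 - q.1‖ ^ 2 - ⟪z - w, p.1 - q.1⟫ := by
    rw [← real_inner_self_eq_norm_sq, ← neg_sub p.1 q.1, inner_neg_right, neg_add_eq_sub,
      ← inner_sub_left, ← inner_sub_left]
    congr 1
    abel
  have h3 := real_inner_le_norm (z - w) (p.1 - q.1)
  by_contra! hlt
  nlinarith [norm_nonneg (z - w)]

/-- A Lions–Stampacchia theorem: if `⟪y, T y⟫ = -‖y‖² / 2`, then some point of `E` solves the
variational inequality driven by `T`. -/
theorem exists_variational_inequality_s7 [CompleteSpace H] {E : Set (H × ℝ)} (hne : E.Nonempty)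
    (hcl : IsClosed E) (hco : Convex ℝ E) {a : H} {c : ℝ} (hlb : ∀ p ∈ E, ⟪a, p.1⟫ - c ≤ p.2)
    (T : H →L[ℝ] H) (hT : ∀ y, ⟪y, T y⟫ + (1 / 2) * ‖y‖ ^ 2 = 0) :
    ∃ p ∈ E, ∀ q ∈ E, p.2 + ⟪q.1 - p.1, T p.1⟫ ≤ q.2 := by
  set M : ℝ := ‖T‖ + 1
  have hM1 : 1 ≤ M := by linarith [norm_nonneg T]
  set ρ : ℝ := 1 / (2 * M ^ 2) with hρdef
  have hρ : 0 < ρ := by positivity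
  have hρM : ρ * M ^ 2 = 1 / 2 := by
    rw [hρdef]; field_simp
  have hρ1 : ρ ≤ 1 := by nlinarith
  have hprox : ∀ z : H, ∃ p ∈ E, ∀ q ∈ E, ρ * p.2 + ⟪z - p.1, q.1 - p.1⟫ ≤ ρ * q.2 := by
    intro z
    obtain ⟨p, hp, hmin⟩ := exists_forall_proximal_le hne hcl hco hlb hρ z
    exact ⟨p, hp, proximal_variational_inequality hco hp hmin⟩
  choose P hPE hP using hprox
  set K : ℝ := √(1 - ρ / 2) with hK
  have hK1 : K < 1 := by
    rw [hK, Real.sqrt_lt' one_pos]; linarith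
  have hstep : ∀ y : H, ‖y + ρ • T y‖ ≤ K * ‖y‖ := by
    intro y
    have hTy : ‖T y‖ ≤ M * ‖y‖ := (T.le_opNorm y).trans (by gcongr; linarith)
    have hsq : ‖T y‖ ^ 2 ≤ M ^ 2 * ‖y‖ ^ 2 := by
      rw [← mul_pow]; gcongr
    have hKsq : K ^ 2 = 1 - ρ / 2 := Real.sq_sqrt (by linarith)
    refine (sq_le_sq₀ (by positivity) (by positivity)).1 ?_
    rw [norm_add_sq_real, real_inner_smul_right, norm_smul, mul_pow, mul_pow, hKsq,
      Real.norm_eq_abs, sq_abs]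
    have h1 : ρ ^ 2 * ‖T y‖ ^ 2 ≤ ρ / 2 * ‖y‖ ^ 2 := by
      calc ρ ^ 2 * ‖T y‖ ^ 2 ≤ ρ ^ 2 * (M ^ 2 * ‖y‖ ^ 2) := by gcongr
        _ = ρ * (ρ * M ^ 2) * ‖y‖ ^ 2 := by ring
        _ = ρ / 2 * ‖y‖ ^ 2 := by rw [hρM]; ring
    have h2 : ⟪y, T y⟫ = -((1 / 2) * ‖y‖ ^ 2) := by linarith [hT y]
    rw [h2]
    linarith
  have hcontr : ContractingWith ⟨K, Real.sqrt_nonneg _⟩ fun y => (P (y + ρ • T y)).1 := by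
    refine ⟨hK1, LipschitzWith.of_dist_le_mul fun y w => ?_⟩
    rw [dist_eq_norm, dist_eq_norm]
    refine (proximal_nonexpansive (hPE _) (hPE _) (hP _) (hP _)).trans ?_
    have e : y + ρ • T y - (w + ρ • T w) = (y - w) + ρ • T (y - w) := by
      rw [map_sub]; module
    rw [e]
    exact hstep _
  have : Nonempty H := ⟨0⟩
  set d := ContractingWith.fixedPoint _ hcontr
  have hfix : (P (d + ρ • T d)).1 = d := hcontr.fixedPoint_isFixedPt
  refine ⟨P (d + ρ • T d), hPE _, fun q hq => ?_⟩
  have h := hP (d + ρ • T d) q hq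
  rw [hfix, add_sub_cancel_left, real_inner_smul_left, real_inner_comm, ← mul_add] at h
  rw [hfix]
  exact le_of_mul_le_mul_left h hρ

end Proximal

theorem fenchel_le_coe_iff {H : Type*} [NormedAddCommGroup H] [InnerProductSpace ℝ H]
    {f : H → EReal} (hf : ∀ x, f x ≠ ⊥) (p : H) (t : ℝ) :
    fenchel f p ≤ t ↔ ∀ x, f x ≠ ⊤ → ⟪x, p⟫ - (f x).toReal ≤ t := by
  rw [fenchel, iSup_le_iff]
  refine forall_congr' fun x => ?_
  by_cases hx : f x = ⊤
  · simp [hx]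
  · lift f x to ℝ using ⟨hx, hf x⟩ with r
    simp only [ne_eq, EReal.coe_ne_top, not_false_eq_true, forall_const, EReal.toReal_coe]
    norm_cast

/-- The real epigraph of the restriction of a Fenchel conjugate to a subspace. -/
def fenchelEpigraph {X : Type*} [NormedAddCommGroup X] [InnerProductSpace ℝ X]
    (Y : Submodule ℝ X) (f : X → EReal) : Set (Y × ℝ) :=
  {p | fenchel f (p.1 : X) ≤ (p.2 : EReal)}

section Epigraph

variable {X : Type*} [NormedAddCommGroup X] [InnerProductSpace ℝ X] (Y : Submodule ℝ X)
  {f : X → EReal}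

theorem mem_fenchelEpigraph_iff (hf : ∀ x, f x ≠ ⊥) (p : Y × ℝ) :
    p ∈ fenchelEpigraph Y f ↔ ∀ x, f x ≠ ⊤ → ⟪x, (p.1 : X)⟫ - (f x).toReal ≤ p.2 :=
  fenchel_le_coe_iff hf _ _

theorem isClosed_fenchelEpigraph (hf : ∀ x, f x ≠ ⊥) : IsClosed (fenchelEpigraph Y f) := by
  have e : fenchelEpigraph Y f
      = ⋂ x, ⋂ _ : f x ≠ ⊤, {p : Y × ℝ | ⟪x, (p.1 : X)⟫ - (f x).toReal ≤ p.2} := by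
    ext p
    simp only [mem_fenchelEpigraph_iff Y hf, Set.mem_iInter, Set.mem_ofPred_eq]
  rw [e]
  exact isClosed_iInter fun x => isClosed_iInter fun _ =>
    isClosed_le (by fun_prop) (by fun_prop)

theorem convex_fenchelEpigraph (hf : ∀ x, f x ≠ ⊥) : Convex ℝ (fenchelEpigraph Y f) := by
  intro p hp q hq a b ha hb hab
  rw [mem_fenchelEpigraph_iff Y hf] at *
  intro x hx
  have h1 := mul_le_mul_of_nonneg_left (hp x hx) ha
  have h2 := mul_le_mul_of_nonneg_left (hq x hx) hb
  simp only [Prod.fst_add, Prod.snd_add, Prod.smul_fst, Prod.smul_snd, smul_eq_mul,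
    Submodule.coe_add, Submodule.coe_smul, inner_add_right, real_inner_smul_right]
  have e : (f x).toReal = a * (f x).toReal + b * (f x).toReal := by rw [← add_mul, hab, one_mul]
  linarith

end Epigraph

/-- A proper function is finite wherever its subdifferential is nonempty. -/
theorem ne_top_of_mem_subdiff {H : Type*} [NormedAddCommGroup H] [InnerProductSpace ℝ H]
    {g : H → EReal} (hg : IsProperFn g) {y p : H} (hp : p ∈ subdiff g y) : g y ≠ ⊤ := by
  obtain ⟨z, hz⟩ := hg.2
  intro htop
  have h := hp z
  rw [htop, EReal.top_add_coe, top_le_iff] at h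
  exact hz h

/-- The subdifferential of a proper function is a monotone operator. -/
theorem inner_sub_nonneg_of_mem_subdiff {H : Type*} [NormedAddCommGroup H]
    [InnerProductSpace ℝ H] {g : H → EReal} (hg : IsProperFn g) {y z p q : H}
    (hp : p ∈ subdiff g y) (hq : q ∈ subdiff g z) : 0 ≤ ⟪y - z, p - q⟫ := by
  have h1 := hp z
  have h2 := hq y
  lift g y to ℝ using ⟨ne_top_of_mem_subdiff hg hp, hg.1 y⟩ with r
  lift g z to ℝ using ⟨ne_top_of_mem_subdiff hg hq, hg.1 z⟩ with s
  norm_cast at h1 h2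
  rw [← neg_sub y z, inner_neg_left] at h1
  rw [inner_sub_right]
  linarith

theorem stmt_7 {X : Type*} [NormedAddCommGroup X] [InnerProductSpace ℝ X] [CompleteSpace X]
    (Y : Submodule ℝ X) (hY : IsClosed (Y : Set X))
    (Q : X →L[ℝ] Y)
    (hQ : ∀ y : Y, ⟪y, Q (y : X)⟫ + (1 / 2) * ‖y‖ ^ 2 = 0)
    (f : X → EReal) (hf : IsProperFn f) (hconv : IsConvexFn f)
    (hlsc : LowerSemicontinuous f)
    (hres : IsProperFn (fun y : Y => fenchel f (y : X))) :
    ∃! p : Y × Y, p.2 = Q (p.1 : X) ∧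
      p.2 ∈ subdiff (fun y : Y => fenchel f (y : X)) p.1 := by
  set g : Y → EReal := fun y => fenchel f (y : X)
  have : CompleteSpace Y := hY.completeSpace_coe
  have hne : (fenchelEpigraph Y f).Nonempty := by
    obtain ⟨y, hy⟩ := hres.2
    exact ⟨(y, (g y).toReal), (EReal.coe_toReal hy (hres.1 y)).ge⟩
  obtain ⟨x₀, hx₀⟩ := hf.2
  have hlb : ∀ p ∈ fenchelEpigraph Y f,
      ⟪Y.orthogonalProjectionOnto x₀, p.1⟫ - (f x₀).toReal ≤ p.2 := by
    intro p hp
    rw [Submodule.inner_orthogonalProjectionOnto_eq_of_mem_right]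
    exact (mem_fenchelEpigraph_iff Y hf.1 p).1 hp x₀ hx₀
  obtain ⟨⟨d, s⟩, hds, hvar⟩ := exists_variational_inequality_s7 hne
    (isClosed_fenchelEpigraph Y hf.1) (convex_fenchelEpigraph Y hf.1) hlb (Q.comp Y.subtypeL) hQ
  have hsub : Q (d : X) ∈ subdiff g d := by
    intro z
    by_cases hz : g z = ⊤
    · rw [hz]; exact le_top
    have hcoe : ((g z).toReal : EReal) = g z := EReal.coe_toReal hz (hres.1 z)
    have h : s + ⟪z - d, Q (d : X)⟫ ≤ (g z).toReal := hvar (z, (g z).toReal) hcoe.ge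
    calc g d + ((⟪z - d, Q (d : X)⟫ : ℝ) : EReal)
        ≤ (s : EReal) + ((⟪z - d, Q (d : X)⟫ : ℝ) : EReal) := by gcongr; exact hds
      _ ≤ ((g z).toReal : EReal) := by exact_mod_cast h
      _ = g z := hcoe
  refine ⟨(d, Q (d : X)), ⟨rfl, hsub⟩, ?_⟩
  rintro ⟨d', e'⟩ ⟨he', hsub'⟩
  dsimp only at he' hsub'
  subst he'
  have hmono := inner_sub_nonneg_of_mem_subdiff hres hsub' hsub
  have hQd := hQ (d' - d)
  rw [Submodule.coe_sub, map_sub] at hQd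
  have hzero : ‖d' - d‖ = 0 := by nlinarith [sq_nonneg ‖d' - d‖, norm_nonneg (d' - d)]
  rw [norm_sub_eq_zero_iff] at hzero
  rw [hzero]
end
end

section
/- Let X be a real Hilbert space and Y a closed subspace of X. Let S be a bounded linear operator from X to Y whose restriction S|_Y : Y → Y is bijective, and suppose ⟪x, Sx⟫ + ½‖Sx‖² = 0 for all x ∈ X. Let f : X → (−∞, ∞] be proper, convex and lower semicontinuous with f*|_Y proper, and let e ∈ Y be the fixed point of ∂(f*|_Y) ∘ S|_Y (i.e. e ∈ ∂(f*|_Y)(Se)). If x ∈ X, f(x) is finite, and f(x) ≤ (f*|_Y)*(e), then the following are equivalent: (i) Sx ∈ ∂f(x); (ii) f*(Sx) + ½‖Sx‖² + f(x) = 0; (iii) Sx = Se. -/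
open scoped RealInnerProductSpace

noncomputable section

/-- The Fenchel–Young inequality at a point where `f` is finite. -/
theorem inner_sub_le_fenchel {H : Type*} [NormedAddCommGroup H] [InnerProductSpace ℝ H]
    {f : H → EReal} {x : H} {r : ℝ} (hx : f x = r) (p : H) :
    ((⟪x, p⟫ - r : ℝ) : EReal) ≤ fenchel f p := by
  rw [EReal.coe_sub, ← hx]
  exact le_iSup (fun z : H => ((⟪z, p⟫ : ℝ) : EReal) - f z) x

/-- Subgradients are characterized by equality in the Fenchel–Young inequality. -/
theorem mem_subdiff_iff_fenchel_eq {H : Type*} [NormedAddCommGroup H] [InnerProductSpace ℝ H]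
    {f : H → EReal} {x : H} {r : ℝ} (hx : f x = r) (p : H) :
    p ∈ subdiff f x ↔ fenchel f p = ((⟪x, p⟫ - r : ℝ) : EReal) := by
  rw [le_antisymm_iff, and_iff_left (inner_sub_le_fenchel hx p), fenchel, iSup_le_iff]
  refine forall_congr' fun z => ?_
  rw [hx, inner_sub_left]
  induction f z with
  | bot => simp [← EReal.coe_add, -EReal.coe_sub]
  | top => simp
  | coe t =>
    norm_cast
    constructor <;> intro h <;> linarith

theorem stmt_10 {X : Type*} [NormedAddCommGroup X] [InnerProductSpace ℝ X] [CompleteSpace X]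
    (Y : Submodule ℝ X) (hY : IsClosed (Y : Set X))
    (S : X →L[ℝ] Y)
    (hbij : Function.Bijective (fun y : Y => S (y : X)))
    (hS : ∀ x : X, ⟪x, ((S x : Y) : X)⟫ + (1 / 2) * ‖S x‖ ^ 2 = 0)
    (f : X → EReal) (hf : IsProperFn f) (hconv : IsConvexFn f)
    (hlsc : LowerSemicontinuous f)
    (hres : IsProperFn (fun y : Y => fenchel f (y : X)))
    (e : Y) (he : e ∈ subdiff (fun y : Y => fenchel f (y : X)) (S (e : X)))
    (x : X) (hfin : f x ≠ ⊤ ∧ f x ≠ ⊥)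
    (hle : f x ≤ fenchel (fun y : Y => fenchel f (y : X)) e) :
    (((S x : Y) : X) ∈ subdiff f x ↔
        fenchel f ((S x : Y) : X) + (((1 / 2) * ‖S x‖ ^ 2 : ℝ) : EReal) + f x = 0) ∧
      (fenchel f ((S x : Y) : X) + (((1 / 2) * ‖S x‖ ^ 2 : ℝ) : EReal) + f x = 0 ↔
        S x = S (e : X)) := by
  have inner_map (a : X) : ⟪a, ((S a : Y) : X)⟫ = -((1 / 2) * ‖S a‖ ^ 2) := by
    linarith [hS a]
  obtain ⟨r, hr⟩ : ∃ r : ℝ, f x = r := ⟨_, (EReal.coe_toReal hfin.1 hfin.2).symm⟩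
  have hSe_ne_top : fenchel f ((S (e : X) : Y) : X) ≠ ⊤ := by
    obtain ⟨z, hz⟩ := hres.2
    intro htop
    have hez := he z
    simp only [htop, EReal.top_add_coe, top_le_iff] at hez
    exact hz hez
  obtain ⟨t, ht⟩ : ∃ t : ℝ, fenchel f ((S (e : X) : Y) : X) = t :=
    ⟨_, (EReal.coe_toReal hSe_ne_top (hres.1 _)).symm⟩
  have hconj := (mem_subdiff_iff_fenchel_eq (f := fun y : Y => fenchel f (y : X)) ht e).1 he
  have hSe_inner : ⟪S (e : X), e⟫ = -((1 / 2) * ‖S (e : X)‖ ^ 2) := by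
    rw [real_inner_comm, ← inner_map e, Submodule.coe_inner]
  rw [hr, hconj, hSe_inner, EReal.coe_le_coe_iff] at hle
  have hyoung := inner_sub_le_fenchel hr ((S (e : X) : Y) : X)
  rw [ht, EReal.coe_le_coe_iff] at hyoung
  constructor
  · rw [mem_subdiff_iff_fenchel_eq hr, inner_map, hr]
    have hbot : fenchel f ((S x : Y) : X) ≠ ⊥ := hres.1 (S x)
    generalize fenchel f ((S x : Y) : X) = c at hbot
    induction c with
    | bot => exact absurd rfl hbot
    | top => simp [-EReal.coe_sub, -EReal.coe_mul]
    | coe c =>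
      norm_cast
      constructor <;> intro h <;> linarith
  · constructor
    · intro h
      have hSx_ne_top : fenchel f ((S x : Y) : X) ≠ ⊤ := by
        intro htop
        rw [htop, hr, EReal.top_add_coe, EReal.top_add_coe] at h
        exact EReal.top_ne_zero h
      obtain ⟨s, hs⟩ : ∃ s : ℝ, fenchel f ((S x : Y) : X) = s :=
        ⟨_, (EReal.coe_toReal hSx_ne_top (hres.1 _)).symm⟩
      rw [hs, hr] at h
      norm_cast at h
      have hyoung_e := inner_sub_le_fenchel (f := fun y : Y => fenchel f (y : X)) hs e
      rw [hconj, hSe_inner, EReal.coe_le_coe_iff, real_inner_comm, Submodule.coe_inner] at hyoung_e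
      have hdiff := inner_map (x - e)
      simp only [map_sub, Submodule.coe_sub, inner_sub_left, inner_sub_right, inner_map] at hdiff
      have hnorm : ‖S x - S (e : X)‖ ^ 2 ≤ 0 := by linarith
      exact sub_eq_zero.1 (norm_eq_zero.1 (pow_eq_zero_iff two_ne_zero |>.1
        (le_antisymm hnorm (sq_nonneg _))))
    · intro h
      have hyoung_x := inner_map x
      rw [h] at hyoung_x ⊢
      rw [ht, hr]
      norm_cast
      linarith
end
end
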